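/- There is no compact metrizable space X such that every continuum is homeomorphic to exactly one connected component of X. -/

import Mathlib

open TopologicalSpace

/-- The assertion that there is a compact metrizable space `X` such that every
continuum (nonempty compact connected metrizable space) is homeomorphic to exactly one
connected component of `X`. -/
inductive UniversalUniqueComponentSpace : Prop where
  | intro (X : Type) [tX : TopologicalSpace X]
      (hcomp : CompactSpace X) (hmetr : MetrizableSpace X)
      (huniq : ∀ (C : Type) [TopologicalSpace C] [CompactSpace C] [ConnectedSpace C]
        [MetrizableSpace C], ∃! S : Set X, (∃ x : X, S = connectedComponent x) ∧
          Nonempty (C ≃ₜ S)) : UniversalUniqueComponentSpace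

namespace UC

open Set Filter Topology

/-! ### Baire category on the full shift -/

/-- The shift by `k`. -/
def sh (k : ℤ) (x : ℤ → Bool) : ℤ → Bool := fun n => x (n + k)

lemma sh_homeo (k : ℤ) : ∃ h : (ℤ → Bool) ≃ₜ (ℤ → Bool), ⇑h = sh k := by
  refine ⟨⟨⟨sh k, sh (-k), ?_, ?_⟩, ?_, ?_⟩, rfl⟩
  · intro x; funext n; simp [sh]
  · intro x; funext n; simp [sh]
  · exact continuous_pi fun n => continuous_apply _
  · exact continuous_pi fun n => continuous_apply _

lemma open_agree {U : Set (ℤ → Bool)} (hU : IsOpen U) {u : ℤ → Bool} (hu : u ∈ U) :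
    ∃ N : ℤ, 0 ≤ N ∧ ∀ v : ℤ → Bool, (∀ n, |n| ≤ N → v n = u n) → v ∈ U := by
  obtain ⟨I, w, hw, hI⟩ := isOpen_pi_iff.1 hU u hu
  refine ⟨∑ i ∈ I, |i|, Finset.sum_nonneg fun i _ => abs_nonneg i, fun v hv => hI ?_⟩
  intro i hi
  rw [hv i (Finset.single_le_sum (f := fun i : ℤ => |i|) (fun i _ => abs_nonneg i) hi)]
  exact (hw i hi).2

lemma transitive {U V : Set (ℤ → Bool)} (hU : IsOpen U) (hV : IsOpen V)
    (hUn : U.Nonempty) (hVn : V.Nonempty) : ∃ k : ℤ, ∃ z ∈ V, sh k z ∈ U := by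
  obtain ⟨u, hu⟩ := hUn
  obtain ⟨v, hv⟩ := hVn
  obtain ⟨N, hN, hNU⟩ := open_agree hU hu
  obtain ⟨M, hM, hMV⟩ := open_agree hV hv
  refine ⟨N + M + 1, fun n => if |n| ≤ M then v n else u (n - (N + M + 1)), ?_, ?_⟩
  · apply hMV
    intro n hn
    simp [hn]
  · apply hNU
    intro n hn
    have : ¬ |n + (N + M + 1)| ≤ M := by
      rw [abs_le] at *
      omega
    simp [sh, this]

lemma zero_one {A : Set (ℤ → Bool)} (hA : BaireMeasurableSet A)
    (hinv : ∀ k x, x ∈ A ↔ sh k x ∈ A) : A ∈ residual _ ∨ Aᶜ ∈ residual (ℤ → Bool) := by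
  obtain ⟨u, hu, hAu⟩ := hA.residualEq_isOpen
  rcases u.eq_empty_or_nonempty with rfl | hne
  · right
    filter_upwards [Filter.eventuallyEq_set.1 hAu] with x hx
    simpa using hx
  · left
    have h1 : ∀ k : ℤ, ∀ᶠ x in residual (ℤ → Bool), (x ∈ A ↔ sh k x ∈ u) := by
      intro k
      obtain ⟨h, hh⟩ := sh_homeo k
      have := (tendsto_residual_of_isOpenMap h.continuous h.isOpenMap).eventually
        (Filter.eventuallyEq_set.1 hAu)
      filter_upwards [this] with x hx
      rw [hinv k x, ← hh, hx]
    have h2 : (⋃ k : ℤ, sh k ⁻¹' u) ∈ residual (ℤ → Bool) := by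
      apply residual_of_dense_open
      · refine isOpen_iUnion fun k => ?_
        obtain ⟨h, hh⟩ := sh_homeo k
        rw [← hh]
        exact hu.preimage h.continuous
      · rw [dense_iff_inter_open]
        intro V hV hVn
        obtain ⟨k, z, hz, hz'⟩ := transitive hu hV hne hVn
        exact ⟨z, hz, mem_iUnion.2 ⟨k, hz'⟩⟩
    filter_upwards [eventually_countable_forall.2 h1, h2] with x hx hx2
    obtain ⟨k, hk⟩ := mem_iUnion.1 hx2
    exact (hx k).2 hk

lemma countable_compl {S : Set (ℤ → Bool)} (hS : S.Countable) : Sᶜ ∈ residual (ℤ → Bool) := by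
  have : ∀ s ∈ S, ∀ᶠ x in residual (ℤ → Bool), x ≠ s := by
    intro s _
    apply residual_of_dense_open (s := {s}ᶜ) isOpen_compl_singleton
    rw [dense_iff_inter_open]
    rintro V hV ⟨v, hv⟩
    obtain ⟨N, hN, h⟩ := open_agree hV hv
    refine ⟨Function.update v (N + 1) (!(s (N + 1))), h _ ?_, ?_⟩
    · intro n hn
      rw [Function.update_of_ne]
      rintro rfl
      rw [abs_le] at hn
      omega
    · intro h'
      have := congrFun h' (N + 1)
      simp at this
  filter_upwards [(eventually_countable_ball hS).2 this] with x hx hxs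
  exact hx x hxs rfl

/-! ### Analyticity -/

lemma meas_proj {P Q : Type} [TopologicalSpace P] [MetrizableSpace P] [MeasurableSpace P]
    [BorelSpace P] [TopologicalSpace Q] [CompactSpace Q] [MetrizableSpace Q]
    {C O : Set (P × Q)} (hC : IsClosed C) (hO : IsOpen O) :
    MeasurableSet {p : P | ∃ q, (p, q) ∈ C ∧ (p, q) ∈ O} := by
  let := metrizableSpaceMetric P
  let := metrizableSpaceMetric Q
  obtain ⟨F, hF, -, hFO, -⟩ := hO.exists_iUnion_isClosed
  have : {p : P | ∃ q, (p, q) ∈ C ∧ (p, q) ∈ O} = ⋃ n, Prod.fst '' (C ∩ F n) := by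
    ext p
    simp only [← hFO, mem_ofPred_eq, mem_iUnion, mem_image, mem_inter_iff, Prod.exists]
    constructor
    · rintro ⟨q, h1, n, h2⟩
      exact ⟨n, p, q, ⟨h1, h2⟩, rfl⟩
    · rintro ⟨n, p', q, ⟨h1, h2⟩, rfl⟩
      exact ⟨q, h1, n, h2⟩
  rw [this]
  exact MeasurableSet.iUnion fun n =>
    (isClosedMap_fst_of_compactSpace _ (hC.inter (hF n))).measurableSet

lemma closed_comp {X : Type} [TopologicalSpace X] [CompactSpace X] [T2Space X] :
    IsClosed {p : X × X | p.2 ∈ connectedComponent p.1} := by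
  have : {p : X × X | p.2 ∈ connectedComponent p.1} =
      {p : X × X | ConnectedComponents.mk p.1 = ConnectedComponents.mk p.2} := by
    ext p
    simp only [mem_ofPred_eq, ConnectedComponents.coe_eq_coe]
    exact ⟨fun h => connectedComponent_eq h, fun h => h ▸ mem_connectedComponent⟩
  rw [this]
  exact isClosed_eq (ConnectedComponents.continuous_coe.comp continuous_fst)
    (ConnectedComponents.continuous_coe.comp continuous_snd)

lemma analytic {Z X : Type} [TopologicalSpace Z] [PolishSpace Z]
    [TopologicalSpace X] [CompactSpace X] [MetrizableSpace X]
    (K : Z → Set (ℝ × ℝ)) (hK : IsClosed {p : Z × (ℝ × ℝ) | p.2 ∈ K p.1})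
    (B : Set (ℝ × ℝ)) (hB : IsCompact B) (hKB : ∀ z, K z ⊆ B) (U : Set X) (hU : IsClosed U) :
    MeasureTheory.AnalyticSet
      {z | ∃ p ∈ U, Nonempty (K z ≃ₜ connectedComponent p)} := by
  let := metrizableSpaceMetric X
  let _ : CompactSpace B := isCompact_iff_compactSpace.1 hB
  let _ : MeasurableSpace (Z × (X × C(X, ℝ × ℝ))) := borel (Z × (X × C(X, ℝ × ℝ)))
  have : BorelSpace (Z × (X × C(X, ℝ × ℝ))) := ⟨rfl⟩
  have hev : Continuous fun q : C(X, ℝ × ℝ) × X => q.1 q.2 := by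
    exact continuous_eval
  have : PolishSpace C(X, ℝ × ℝ) := inferInstance
  let S1 : Set (Z × (X × C(X, ℝ × ℝ))) := {a | ∃ q : X × X, (a, q) ∈ {b : (Z × (X × C(X, ℝ × ℝ))) × (X × X) |
      b.2.1 ∈ connectedComponent b.1.2.1 ∧ b.2.2 ∈ connectedComponent b.1.2.1 ∧
      b.1.2.2 b.2.1 = b.1.2.2 b.2.2} ∧ (a, q) ∈ {b : (Z × (X × C(X, ℝ × ℝ))) × (X × X) | b.2.1 ≠ b.2.2}}
  have hS1 : MeasurableSet S1 := by
    apply meas_proj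
    · refine IsClosed.inter ?_ (IsClosed.inter ?_ ?_)
      · exact closed_comp.preimage (f := fun b : (Z × (X × C(X, ℝ × ℝ))) × (X × X) => (b.1.2.1, b.2.1)) (by fun_prop)
      · exact closed_comp.preimage (f := fun b : (Z × (X × C(X, ℝ × ℝ))) × (X × X) => (b.1.2.1, b.2.2)) (by fun_prop)
      · exact isClosed_eq
          (hev.comp (g := fun q : C(X, ℝ × ℝ) × X => q.1 q.2)
            (f := fun b : (Z × (X × C(X, ℝ × ℝ))) × (X × X) => (b.1.2.2, b.2.1)) (by fun_prop))
          (hev.comp (g := fun q : C(X, ℝ × ℝ) × X => q.1 q.2)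
            (f := fun b : (Z × (X × C(X, ℝ × ℝ))) × (X × X) => (b.1.2.2, b.2.2)) (by fun_prop))
    · exact isOpen_ne_fun (by fun_prop) (by fun_prop)
  let S2 : Set (Z × (X × C(X, ℝ × ℝ))) := {a | ∃ q : X, (a, q) ∈ {b : (Z × (X × C(X, ℝ × ℝ))) × X |
      b.2 ∈ connectedComponent b.1.2.1} ∧ (a, q) ∈ {b : (Z × (X × C(X, ℝ × ℝ))) × X | b.1.2.2 b.2 ∈ K b.1.1}ᶜ}
  have hS2 : MeasurableSet S2 := by
    apply meas_proj
    · exact closed_comp.preimage (f := fun b : (Z × (X × C(X, ℝ × ℝ))) × X => (b.1.2.1, b.2)) (by fun_prop)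
    · refine IsClosed.isOpen_compl (self := ?_)
      refine hK.preimage (f := fun b : (Z × (X × C(X, ℝ × ℝ))) × X => (b.1.1, b.1.2.2 b.2)) ?_
      exact Continuous.prodMk (by fun_prop) (hev.comp (g := fun q : C(X, ℝ × ℝ) × X => q.1 q.2)
            (f := fun b : (Z × (X × C(X, ℝ × ℝ))) × X => (b.1.2.2, b.2)) (by fun_prop))
  let S3 : Set (Z × (X × C(X, ℝ × ℝ))) := {a | ∃ q : B, (a, q) ∈ {b : (Z × (X × C(X, ℝ × ℝ))) × B | b.2.1 ∈ K b.1.1} ∧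
    (a, q) ∈ {b : (Z × (X × C(X, ℝ × ℝ))) × B | ∃ r, (b, r) ∈ {c : ((Z × (X × C(X, ℝ × ℝ))) × B) × X | c.2 ∈ connectedComponent c.1.1.2.1 ∧
      c.1.1.2.2 c.2 = c.1.2.1}}ᶜ}
  have hS3 : MeasurableSet S3 := by
    apply meas_proj
    · exact hK.preimage (f := fun b : (Z × (X × C(X, ℝ × ℝ))) × B => (b.1.1, b.2.1)) (by fun_prop)
    · refine IsClosed.isOpen_compl (self := ?_)
      have : IsClosed {c : ((Z × (X × C(X, ℝ × ℝ))) × B) × X | c.2 ∈ connectedComponent c.1.1.2.1 ∧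
          c.1.1.2.2 c.2 = c.1.2.1} := by
        refine IsClosed.inter ?_ ?_
        · exact closed_comp.preimage
            (f := fun c : ((Z × (X × C(X, ℝ × ℝ))) × B) × X => (c.1.1.2.1, c.2)) (by fun_prop)
        · exact isClosed_eq (hev.comp (g := fun q : C(X, ℝ × ℝ) × X => q.1 q.2)
            (f := fun c : ((Z × (X × C(X, ℝ × ℝ))) × B) × X => (c.1.1.2.2, c.2)) (by fun_prop)) (by fun_prop)
      convert isClosedMap_fst_of_compactSpace _ this using 1
      ext b
      simp
  let S4 : Set (Z × (X × C(X, ℝ × ℝ))) := {a | a.2.1 ∈ U}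
  have hS4 : MeasurableSet S4 := (hU.preimage (f := fun a : (Z × (X × C(X, ℝ × ℝ))) => a.2.1) (by fun_prop)).measurableSet
  have hS : MeasurableSet (S4 \ (S1 ∪ S2 ∪ S3)) := hS4.diff ((hS1.union hS2).union hS3)
  have key := (hS.analyticSet).image_of_continuous (f := (Prod.fst : (Z × (X × C(X, ℝ × ℝ))) → Z)) continuous_fst
  convert key using 1
  ext z
  simp only [mem_ofPred_eq, mem_image]
  constructor
  · rintro ⟨p, hp, ⟨h⟩⟩
    obtain ⟨g, hg⟩ := ContinuousMap.exists_restrict_eq (isClosed_connectedComponent (x := p))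
      (⟨fun a => (h.symm a : ℝ × ℝ), by fun_prop⟩ : C(connectedComponent p, ℝ × ℝ))
    have hg' : ∀ a : connectedComponent p, g a = h.symm a := fun a => congrArg (fun f => f a) hg
    refine ⟨(z, p, g), ⟨hp, ?_⟩, rfl⟩
    rintro ((⟨⟨q, r⟩, ⟨hq, hr, hqr⟩, hne⟩ | ⟨q, hq, hn⟩) | ⟨q, hq, hn⟩)
    · apply hne
      have h1 := hg' ⟨q, hq⟩
      have h2 := hg' ⟨r, hr⟩
      have h3 : h.symm ⟨q, hq⟩ = h.symm ⟨r, hr⟩ :=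
        Subtype.ext (h1.symm.trans (Eq.trans hqr h2))
      exact congrArg Subtype.val (h.symm.injective h3)
    · apply hn
      have h1 := hg' ⟨q, hq⟩
      change g q ∈ K z
      rw [h1]
      exact (h.symm _).2
    · apply hn
      refine ⟨h ⟨q, hq⟩, (h ⟨q, hq⟩).2, ?_⟩
      have h1 := hg' (h ⟨q, hq⟩)
      simpa using h1
  · rintro ⟨⟨z', p, g⟩, ⟨hp, hn⟩, rfl⟩
    refine ⟨p, hp, ?_⟩
    have hn1 : (z', p, g) ∉ S1 := fun h => hn (Or.inl (Or.inl h))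
    have hn2 : (z', p, g) ∉ S2 := fun h => hn (Or.inl (Or.inr h))
    have hn3 : (z', p, g) ∉ S3 := fun h => hn (Or.inr h)
    have hmaps : ∀ q ∈ connectedComponent p, g q ∈ K z' := by
      intro q hq
      by_contra hc
      exact hn2 ⟨q, hq, hc⟩
    have : CompactSpace (connectedComponent p) :=
      isCompact_iff_compactSpace.1 isClosed_connectedComponent.isCompact
    let f : connectedComponent p → K z' := fun q => ⟨g q, hmaps q q.2⟩
    have hf : Continuous f := by fun_prop
    have hbij : Function.Bijective f := by
      constructor
      · intro a b hab
        by_contra hc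
        refine hn1 ⟨(a.1, b.1), ⟨a.2, b.2, congrArg Subtype.val hab⟩, ?_⟩
        exact fun h => hc (Subtype.ext h)
      · intro b
        by_contra hc
        refine hn3 ⟨⟨b.1, hKB _ b.2⟩, b.2, ?_⟩
        rintro ⟨r, hr, hr'⟩
        exact hc ⟨⟨r, hr⟩, Subtype.ext hr'⟩
    exact ⟨(hf.homeoOfEquivCompactToT2 (f := Equiv.ofBijective f hbij)).symm⟩

/-! ### Chains of circles given by a width function -/

/-- `p` lies on every connected set through `q` and `r`. -/
def Sep {T : Type} [TopologicalSpace T] (p q r : T) : Prop :=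
  ∀ C : Set T, IsPreconnected C → q ∈ C → r ∈ C → p ∈ C

/-- `p` separates two other points. -/
def Cut {T : Type} [TopologicalSpace T] (p : T) : Prop :=
  ∃ q r, q ≠ p ∧ r ≠ p ∧ Sep p q r

lemma Sep.map {T T' : Type} [TopologicalSpace T] [TopologicalSpace T'] (h : T ≃ₜ T')
    {p q r : T} (hs : Sep p q r) : Sep (h p) (h q) (h r) := by
  intro C hC hq hr
  exact hs (h ⁻¹' C) (h.isPreconnected_preimage.2 hC) hq hr

lemma Cut.map {T T' : Type} [TopologicalSpace T] [TopologicalSpace T'] (h : T ≃ₜ T')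
    {p : T} (hs : Cut p) : Cut (h p) := by
  obtain ⟨q, r, hq, hr, hs⟩ := hs
  exact ⟨h q, h r, h.injective.ne hq, h.injective.ne hr, hs.map h⟩

/-- Union of the graphs of `w` and `-w` over `[0,1]`. -/
def KK (w : ℝ → ℝ) : Set (ℝ × ℝ) := {q | q.1 ∈ Icc (0 : ℝ) 1 ∧ |q.2| = w q.1}

/-- Admissible width functions. -/
structure Adm (w : ℝ → ℝ) : Prop where
  cont : Continuous w
  nonneg : ∀ t, 0 ≤ w t
  zero : w 0 = 0
  one : w 1 = 0

/-- Upper graph. -/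
noncomputable def up {w : ℝ → ℝ} (hw : Adm w) (s : ℝ) : KK w :=
  ⟨((projIcc (0 : ℝ) 1 zero_le_one s : ℝ), w (projIcc (0 : ℝ) 1 zero_le_one s)),
    (projIcc (0 : ℝ) 1 zero_le_one s).2, abs_of_nonneg (hw.nonneg _)⟩

/-- Lower graph. -/
noncomputable def dn {w : ℝ → ℝ} (hw : Adm w) (s : ℝ) : KK w :=
  ⟨((projIcc (0 : ℝ) 1 zero_le_one s : ℝ), - w (projIcc (0 : ℝ) 1 zero_le_one s)),
    (projIcc (0 : ℝ) 1 zero_le_one s).2, by simpa using abs_of_nonneg (hw.nonneg _)⟩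

section
variable {w : ℝ → ℝ} (hw : Adm w)

lemma up_cont : Continuous (up hw) := by
  have h1 : Continuous fun s => (projIcc (0 : ℝ) 1 zero_le_one s : ℝ) :=
    continuous_subtype_val.comp continuous_projIcc
  exact Continuous.subtype_mk (h1.prodMk (hw.cont.comp h1)) _

lemma dn_cont : Continuous (dn hw) := by
  have h1 : Continuous fun s => (projIcc (0 : ℝ) 1 zero_le_one s : ℝ) :=
    continuous_subtype_val.comp continuous_projIcc
  exact Continuous.subtype_mk (h1.prodMk (hw.cont.comp h1).neg) _

lemma up_val {s : ℝ} (hs : s ∈ Icc (0 : ℝ) 1) : (up hw s).1 = (s, w s) := by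
  simp [up, projIcc_of_mem zero_le_one hs]

lemma dn_val {s : ℝ} (hs : s ∈ Icc (0 : ℝ) 1) : (dn hw s).1 = (s, - w s) := by
  simp [dn, projIcc_of_mem zero_le_one hs]

lemma up_or_dn (q : KK w) : q = up hw q.1.1 ∨ q = dn hw q.1.1 := by
  have h1 := q.2.1
  have h2 := q.2.2
  rcases le_total 0 q.1.2 with h | h
  · left
    apply Subtype.ext
    rw [up_val hw h1, ← h2, abs_of_nonneg h]
  · right
    apply Subtype.ext
    rw [dn_val hw h1, ← h2, abs_of_nonpos h, neg_neg]

lemma eq_up {q : KK w} (h : w q.1.1 = 0) : q = up hw q.1.1 := by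
  have h1 := q.2.1
  have h2 := q.2.2
  rw [h, abs_eq_zero] at h2
  apply Subtype.ext
  rw [up_val hw h1, h, ← h2]

lemma up_eq_dn {s : ℝ} (hs : s ∈ Icc (0 : ℝ) 1) (h : w s = 0) : up hw s = dn hw s := by
  apply Subtype.ext
  rw [up_val hw hs, dn_val hw hs, h, neg_zero]

lemma sep_iff {t a b : ℝ} (ht : t ∈ Icc (0 : ℝ) 1) (ha : a ∈ Icc (0 : ℝ) 1)
    (hb : b ∈ Icc (0 : ℝ) 1) (hwt : w t = 0) :
    Sep (up hw t) (up hw a) (up hw b) ↔ t ∈ uIcc a b := by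
  constructor
  · intro h
    obtain ⟨s, hs, hst⟩ := h (up hw '' uIcc a b)
      (isPreconnected_uIcc.image _ (up_cont hw).continuousOn)
      (mem_image_of_mem _ left_mem_uIcc) (mem_image_of_mem _ right_mem_uIcc)
    have hs' : s ∈ Icc (0 : ℝ) 1 := (uIcc_subset_Icc ha hb) hs
    have := congrArg (fun q => q.1.1) hst
    simp only [up_val hw hs', up_val hw ht] at this
    rwa [← this]
  · intro h C hC hCa hCb
    have h1 : IsPreconnected ((fun q : KK w => q.1.1) '' C) :=
      hC.image _ (by fun_prop)
    have h2 : t ∈ (fun q : KK w => q.1.1) '' C := by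
      refine h1.ordConnected.uIcc_subset (x := a) (y := b) ?_ ?_ h
      · exact ⟨_, hCa, by simp [up_val hw ha]⟩
      · exact ⟨_, hCb, by simp [up_val hw hb]⟩
    obtain ⟨q, hq, rfl⟩ := h2
    rwa [← eq_up hw hwt]

lemma not_cut_of {p : KK w} (S : Set (KK w)) (hS : IsPreconnected S) (hp : p ∉ S)
    (h : ∀ q, q ≠ p → q ∈ S) : ¬ Cut p := by
  rintro ⟨q, r, hq, hr, hs⟩
  exact hp (hs S hS (h q hq) (h r hr))

lemma not_cut_aux {f g : ℝ → KK w} (hf : Continuous f) (hg : Continuous g)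
    (h0 : f 0 = g 0) (h1 : f 1 = g 1) (hfg : ∀ q : KK w, q = f q.1.1 ∨ q = g q.1.1)
    (hfv : ∀ s ∈ Icc (0 : ℝ) 1, (f s).1.1 = s) (hgv : ∀ s ∈ Icc (0 : ℝ) 1, (g s).1.1 = s)
    {t : ℝ} (ht : t ∈ Icc (0 : ℝ) 1) (hne : f t ≠ g t) : ¬ Cut (f t) := by
  have ht0 : 0 < t := by
    rcases ht.1.eq_or_lt with h | h
    · subst h; exact absurd h0 hne
    · exact h
  have ht1 : t < 1 := by
    rcases ht.2.eq_or_lt with h | h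
    · subst h; exact absurd h1 hne
    · exact h
  apply not_cut_of (f '' Ico 0 t ∪ g '' Icc 0 1 ∪ f '' Ioc t 1)
  · refine IsPreconnected.union (f 1) ?_ ?_ (IsPreconnected.union (f 0) ?_ ?_ ?_ ?_) ?_
    · exact Or.inr ⟨1, by simp, h1.symm⟩
    · exact ⟨1, ⟨ht1, le_rfl⟩, rfl⟩
    · exact ⟨0, ⟨le_rfl, ht0⟩, rfl⟩
    · exact ⟨0, by simp, h0.symm⟩
    · exact isPreconnected_Ico.image _ hf.continuousOn
    · exact isPreconnected_Icc.image _ hg.continuousOn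
    · exact isPreconnected_Ioc.image _ hf.continuousOn
  · rintro ((⟨s, hs, h⟩ | ⟨s, hs, h⟩) | ⟨s, hs, h⟩)
    · have := congrArg (fun q : KK w => q.1.1) h
      beta_reduce at this
      rw [hfv s ⟨hs.1, hs.2.le.trans ht.2⟩, hfv t ht] at this
      exact hs.2.ne this
    · have := congrArg (fun q : KK w => q.1.1) h
      beta_reduce at this
      rw [hgv s hs, hfv t ht] at this
      subst this
      exact hne h.symm
    · have := congrArg (fun q : KK w => q.1.1) h
      beta_reduce at this
      rw [hfv s ⟨ht.1.trans hs.1.le, hs.2⟩, hfv t ht] at this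
      exact hs.1.ne' this
  · intro q hq
    rcases hfg q with h | h
    · rcases lt_trichotomy q.1.1 t with h' | h' | h'
      · exact Or.inl (Or.inl ⟨_, ⟨q.2.1.1, h'⟩, h.symm⟩)
      · exact absurd (h.trans (by rw [h'])) hq
      · exact Or.inr ⟨_, ⟨h', q.2.1.2⟩, h.symm⟩
    · exact Or.inl (Or.inr ⟨_, q.2.1, h.symm⟩)

lemma cut_iff {w : ℝ → ℝ} (hw : Adm w) (p : KK w) : Cut p ↔ w p.1.1 = 0 ∧ p.1.1 ∈ Ioo (0 : ℝ) 1 := by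
  have h0 : (0 : ℝ) ∈ Icc (0 : ℝ) 1 := by simp
  have h1 : (1 : ℝ) ∈ Icc (0 : ℝ) 1 := by simp
  constructor
  · intro hc
    by_contra hn
    by_cases hz : w p.1.1 = 0
    · have hp := eq_up hw hz
      have hb : p.1.1 = 0 ∨ p.1.1 = 1 := by
        by_contra hb
        push Not at hb
        exact hn ⟨hz, lt_of_le_of_ne p.2.1.1 hb.1.symm, lt_of_le_of_ne p.2.1.2 hb.2⟩
      rcases hb with hb | hb
      · refine not_cut_of (up hw '' Ioc 0 1 ∪ dn hw '' Ioc 0 1) ?_ ?_ ?_ hc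
        · refine IsPreconnected.union (up hw 1) ⟨1, by simp, rfl⟩
            ⟨1, by simp, (up_eq_dn hw h1 hw.one).symm⟩
            (isPreconnected_Ioc.image _ (up_cont hw).continuousOn)
            (isPreconnected_Ioc.image _ (dn_cont hw).continuousOn)
        · rintro (⟨s, hs, rfl⟩ | ⟨s, hs, rfl⟩)
          · rw [up_val hw ⟨hs.1.le, hs.2⟩] at hb
            exact hs.1.ne' hb
          · rw [dn_val hw ⟨hs.1.le, hs.2⟩] at hb
            exact hs.1.ne' hb
        · intro q hq
          have hq0 : 0 < q.1.1 := by
            refine lt_of_le_of_ne q.2.1.1 fun h => hq ?_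
            rw [hp, hb, h]
            exact eq_up hw (by rw [← h, hw.zero])
          rcases up_or_dn hw q with h | h
          · exact Or.inl ⟨_, ⟨hq0, q.2.1.2⟩, h.symm⟩
          · exact Or.inr ⟨_, ⟨hq0, q.2.1.2⟩, h.symm⟩
      · refine not_cut_of (up hw '' Ico 0 1 ∪ dn hw '' Ico 0 1) ?_ ?_ ?_ hc
        · refine IsPreconnected.union (up hw 0) ⟨0, by simp, rfl⟩
            ⟨0, by simp, (up_eq_dn hw h0 hw.zero).symm⟩
            (isPreconnected_Ico.image _ (up_cont hw).continuousOn)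
            (isPreconnected_Ico.image _ (dn_cont hw).continuousOn)
        · rintro (⟨s, hs, rfl⟩ | ⟨s, hs, rfl⟩)
          · rw [up_val hw ⟨hs.1, hs.2.le⟩] at hb
            exact hs.2.ne hb
          · rw [dn_val hw ⟨hs.1, hs.2.le⟩] at hb
            exact hs.2.ne hb
        · intro q hq
          have hq0 : q.1.1 < 1 := by
            refine lt_of_le_of_ne q.2.1.2 fun h => hq ?_
            rw [hp, hb, ← h]
            exact eq_up hw (by rw [h, hw.one])
          rcases up_or_dn hw q with h | h
          · exact Or.inl ⟨_, ⟨q.2.1.1, hq0⟩, h.symm⟩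
          · exact Or.inr ⟨_, ⟨q.2.1.1, hq0⟩, h.symm⟩
    · have hne : up hw p.1.1 ≠ dn hw p.1.1 := by
        intro h
        have := congrArg (fun q => q.1.2) h
        simp only [up_val hw p.2.1, dn_val hw p.2.1] at this
        apply hz
        linarith
      rcases up_or_dn hw p with h | h
      · rw [h] at hc
        exact not_cut_aux (up_cont hw) (dn_cont hw) (up_eq_dn hw h0 hw.zero)
          (up_eq_dn hw h1 hw.one) (up_or_dn hw) (fun s hs => by rw [up_val hw hs])
          (fun s hs => by rw [dn_val hw hs]) p.2.1 hne hc
      · rw [h] at hc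
        exact not_cut_aux (dn_cont hw) (up_cont hw) (up_eq_dn hw h0 hw.zero).symm
          (up_eq_dn hw h1 hw.one).symm (fun q => (up_or_dn hw q).symm)
          (fun s hs => by rw [dn_val hw hs])
          (fun s hs => by rw [up_val hw hs]) p.2.1 hne.symm hc
  · rintro ⟨hz, hp⟩
    have hpu := eq_up hw hz
    refine ⟨up hw 0, up hw 1, ?_, ?_, ?_⟩
    · rintro rfl
      rw [up_val hw h0] at hp
      exact lt_irrefl _ hp.1
    · rintro rfl
      rw [up_val hw h1] at hp
      exact lt_irrefl _ hp.2
    · rw [hpu, sep_iff hw p.2.1 h0 h1 hz]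
      rw [uIcc_of_le zero_le_one]
      exact p.2.1

end

/-- Interior zero set. -/
def FF (w : ℝ → ℝ) : Set ℝ := {t | w t = 0 ∧ t ∈ Ioo (0 : ℝ) 1}

lemma theta_maps {w w' : ℝ → ℝ} (hw : Adm w) (hw' : Adm w') (h : KK w ≃ₜ KK w') {t : ℝ}
    (ht : t ∈ FF w) : (h (up hw t)).1.1 ∈ FF w' ∧ h (up hw t) = up hw' (h (up hw t)).1.1 := by
  have hc : Cut (h (up hw t)) := by
    apply Cut.map
    rw [cut_iff hw, up_val hw (Ioo_subset_Icc_self ht.2)]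
    exact ht
  rw [cut_iff hw'] at hc
  exact ⟨hc, eq_up hw' hc.1⟩

lemma homeo_order {w w' : ℝ → ℝ} (hw : Adm w) (hw' : Adm w') (h : KK w ≃ₜ KK w') :
    Nonempty (FF w ≃o FF w') ∨ Nonempty (FF w ≃o (FF w')ᵒᵈ) := by
  let θ : FF w ≃ FF w' :=
    { toFun := fun t => ⟨(h (up hw t)).1.1, (theta_maps hw hw' h t.2).1⟩
      invFun := fun t => ⟨(h.symm (up hw' t)).1.1, (theta_maps hw' hw h.symm t.2).1⟩
      left_inv := by
        intro t
        apply Subtype.ext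
        simp only
        rw [← (theta_maps hw hw' h t.2).2, h.symm_apply_apply,
          up_val hw (Ioo_subset_Icc_self t.2.2)]
      right_inv := by
        intro t
        apply Subtype.ext
        simp only
        rw [← (theta_maps hw' hw h.symm t.2).2, h.apply_symm_apply,
          up_val hw' (Ioo_subset_Icc_self t.2.2)] }
  have hI : ∀ t : FF w, t.1 ∈ Icc (0 : ℝ) 1 := fun t => Ioo_subset_Icc_self t.2.2
  have hI' : ∀ t : FF w', t.1 ∈ Icc (0 : ℝ) 1 := fun t => Ioo_subset_Icc_self t.2.2
  have key : ∀ a b c : FF w, c ∈ uIcc a b → θ c ∈ uIcc (θ a) (θ b) := by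
    intro a b c hc
    have h1 : c.1 ∈ uIcc a.1 b.1 := by
      rw [mem_uIcc] at *
      exact hc
    rw [← sep_iff hw (hI c) (hI a) (hI b) c.2.1] at h1
    have h2 := h1.map h
    rw [(theta_maps hw hw' h a.2).2, (theta_maps hw hw' h b.2).2,
      (theta_maps hw hw' h c.2).2] at h2
    have h3 := (sep_iff hw' (hI' (θ c)) (hI' (θ a)) (hI' (θ b)) (θ c).2.1).1 h2
    rw [mem_uIcc] at *
    exact h3
  rcases monotone_or_antitone_iff_uIcc.2 key with hm | hm
  · left
    exact ⟨(hm.strictMono_of_injective θ.injective).orderIsoOfSurjective _ θ.surjective⟩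
  · right
    have hm' : StrictMono (fun t => OrderDual.toDual (θ t)) := by
      intro a b hab
      exact (hm.strictAnti_of_injective θ.injective) hab
    exact ⟨hm'.orderIsoOfSurjective _ (OrderDual.toDual.surjective.comp θ.surjective)⟩

lemma KK_eq {w : ℝ → ℝ} (hw : Adm w) : range (up hw) ∪ range (dn hw) = univ := by
  rw [eq_univ_iff_forall]
  intro q
  rcases up_or_dn hw q with h | h
  · exact Or.inl ⟨_, h.symm⟩
  · exact Or.inr ⟨_, h.symm⟩

lemma KK_connected {w : ℝ → ℝ} (hw : Adm w) : ConnectedSpace (KK w) := by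
  have : IsPreconnected (univ : Set (KK w)) := by
    rw [← KK_eq hw, ← image_univ, ← image_univ]
    exact IsPreconnected.union (up hw 0) ⟨0, trivial, rfl⟩
      ⟨0, trivial, (up_eq_dn hw (by simp) hw.zero).symm⟩
      (isPreconnected_univ.image _ (up_cont hw).continuousOn)
      (isPreconnected_univ.image _ (dn_cont hw).continuousOn)
  exact { isPreconnected_univ := this, toNonempty := ⟨up hw 0⟩ }

lemma homeo_of {w w' : ℝ → ℝ} (hw : Adm w) (hw' : Adm w') (φ : ℝ → ℝ)
    (hφ : ContinuousOn φ (Icc 0 1)) (hb : BijOn φ (Icc 0 1) (Icc 0 1))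
    (hz : ∀ t ∈ Icc (0 : ℝ) 1, w t = 0 ↔ w' (φ t) = 0) : Nonempty (KK w ≃ₜ KK w') := by
  let Y := ↥(Icc (0 : ℝ) 1) ⊕ ↥(Icc (0 : ℝ) 1)
  let q : Y → KK w := Sum.elim (fun t => up hw t) (fun t => dn hw t)
  let q' : Y → KK w' := Sum.elim (fun t => up hw' (φ t)) (fun t => dn hw' (φ t))
  have hq : Continuous q := Continuous.sumElim ((up_cont hw).comp continuous_subtype_val)
    ((dn_cont hw).comp continuous_subtype_val)
  have hφ' : Continuous fun t : Icc (0 : ℝ) 1 => φ t := continuousOn_iff_continuous_domRestrict.1 hφ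
  have hq' : Continuous q' := Continuous.sumElim ((up_cont hw').comp hφ')
    ((dn_cont hw').comp hφ')
  have hs : Function.Surjective q := by
    intro r
    rcases up_or_dn hw r with h | h
    · exact ⟨Sum.inl ⟨_, r.2.1⟩, h.symm⟩
    · exact ⟨Sum.inr ⟨_, r.2.1⟩, h.symm⟩
  have hs' : Function.Surjective q' := by
    intro r
    obtain ⟨t, ht, htr⟩ := hb.surjOn r.2.1
    rcases up_or_dn hw' r with h | h
    · refine ⟨Sum.inl ⟨t, ht⟩, ?_⟩
      rw [h, ← htr]; rfl
    · refine ⟨Sum.inr ⟨t, ht⟩, ?_⟩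
      rw [h, ← htr]; rfl
  have Q : IsQuotientMap q := hq.isClosedMap.isQuotientMap hq hs
  have Q' : IsQuotientMap q' := hq'.isClosedMap.isQuotientMap hq' hs'
  have hker : Setoid.ker q = Setoid.ker q' := by
    have cond : ∀ a b : ℝ, a ∈ Icc (0 : ℝ) 1 → b ∈ Icc (0 : ℝ) 1 →
        ((a, w a) = (b, - w b) ↔ (φ a, w' (φ a)) = (φ b, - w' (φ b))) := by
      intro a b ha hb'
      simp only [Prod.mk.injEq]
      constructor
      · rintro ⟨rfl, h⟩
        have := (hz a ha).1 (by linarith)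
        simp [this]
      · rintro ⟨h, h'⟩
        have := hb.injOn ha hb' h
        subst this
        have := (hz a ha).2 (by linarith)
        simp [this]
    ext a b
    simp only [Setoid.ker_def]
    rcases a with ⟨a, ha⟩ | ⟨a, ha⟩ <;> rcases b with ⟨b, hb'⟩ | ⟨b, hb'⟩ <;>
      simp only [q, q', Sum.elim_inl, Sum.elim_inr] <;>
      rw [← Subtype.val_inj, ← Subtype.val_inj] <;>
      simp only [up_val hw ha, up_val hw hb', dn_val hw ha, dn_val hw hb',
        up_val hw' (hb.mapsTo ha), up_val hw' (hb.mapsTo hb'), dn_val hw' (hb.mapsTo ha),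
        dn_val hw' (hb.mapsTo hb')]
    · simp only [Prod.mk.injEq]
      constructor
      · rintro ⟨rfl, -⟩; simp
      · rintro ⟨h, -⟩
        have := hb.injOn ha hb' h
        subst this; simp
    · exact cond a b ha hb'
    · rw [eq_comm, cond b a hb' ha, eq_comm]
    · simp only [Prod.mk.injEq]
      constructor
      · rintro ⟨rfl, -⟩; simp
      · rintro ⟨h, -⟩
        have := hb.injOn ha hb' h
        subst this; simp
  have e := IsQuotientMap.homeomorph (f := (⟨q, hq⟩ : C(Y, KK w))) Q
  change Quotient (Setoid.ker q) ≃ₜ _ at e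
  rw [hker] at e
  exact ⟨e.symm.trans (IsQuotientMap.homeomorph (f := (⟨q', hq'⟩ : C(Y, KK w'))) Q')⟩

/-! ### The coding family -/

/-- Left scale. -/
noncomputable def lft (b : Bool) : ℝ := if b then 3 / 2 else 1

/-- Bump on one gap. -/
noncomputable def bump (n : ℤ) (b : Bool) (t : ℝ) : ℝ :=
  max 0 (min 1 (min (t - 2 ^ n * lft b * (1 - t)) (2 ^ (n + 1) * (1 - t) - t)))

/-- Width function coded by `x`. -/
noncomputable def W (x : ℤ → Bool) (t : ℝ) : ℝ :=
  ∑' n : ℤ, (1 / 2 : ℝ) ^ n.natAbs * bump n (x n) t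

lemma bump_nonneg (n b t) : 0 ≤ bump n b t := le_max_left _ _

lemma bump_le (n b t) : bump n b t ≤ 1 := max_le zero_le_one (min_le_left _ _)

lemma bump_eq_zero (n b t) : bump n b t = 0 ↔
    ¬ (2 ^ n * lft b * (1 - t) < t ∧ t < 2 ^ (n + 1) * (1 - t)) := by
  unfold bump
  rw [max_eq_left_iff, ← not_lt, lt_min_iff, lt_min_iff, sub_pos, sub_pos]
  simp

lemma summ : Summable fun n : ℤ => (1 / 2 : ℝ) ^ n.natAbs := by
  have : Summable fun n : ℕ => (1 / 2 : ℝ) ^ n := summable_geometric_two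
  apply Summable.of_nat_of_neg
  · simpa using this
  · simpa using this

lemma bump_norm (n b t) : ‖(1 / 2 : ℝ) ^ n.natAbs * bump n b t‖ ≤ (1 / 2 : ℝ) ^ n.natAbs := by
  rw [Real.norm_of_nonneg (mul_nonneg (by positivity) (bump_nonneg _ _ _))]
  exact mul_le_of_le_one_right (by positivity) (bump_le _ _ _)

lemma W_cont : Continuous fun q : (ℤ → Bool) × ℝ => W q.1 q.2 := by
  unfold W
  refine continuous_tsum (fun n => ?_) summ (fun n q => bump_norm n _ _)
  have h1 : Continuous fun q : (ℤ → Bool) × ℝ => lft (q.1 n) :=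
    (continuous_of_discreteTopology (f := lft)).comp
      ((continuous_apply n).comp continuous_fst)
  unfold bump
  fun_prop

lemma W_summ (x : ℤ → Bool) (t : ℝ) : Summable fun n : ℤ => (1 / 2 : ℝ) ^ n.natAbs * bump n (x n) t :=
  Summable.of_norm_bounded summ fun n => bump_norm n _ _

lemma W_nonneg (x t) : 0 ≤ W x t :=
  tsum_nonneg fun n => mul_nonneg (by positivity) (bump_nonneg _ _ _)

lemma W_le (x t) : W x t ≤ ∑' n : ℤ, (1 / 2 : ℝ) ^ n.natAbs :=
  (W_summ x t).tsum_le_tsum (fun n => (le_abs_self _).trans (bump_norm n _ _)) summ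

lemma W_zero (x : ℤ → Bool) (t : ℝ) : W x t = 0 ↔
    ∀ n : ℤ, ¬ (2 ^ n * lft (x n) * (1 - t) < t ∧ t < 2 ^ (n + 1) * (1 - t)) := by
  unfold W
  rw [← (W_summ x t).hasSum_iff, hasSum_zero_iff_of_nonneg
    (fun n => mul_nonneg (by positivity) (bump_nonneg _ _ _)), funext_iff]
  refine forall_congr' fun n => ?_
  rw [← bump_eq_zero]
  simp

lemma lft_pos (b) : 0 < lft b := by unfold lft; split <;> norm_num

lemma W_adm (x) : Adm (W x) where
  cont := W_cont.comp (by fun_prop : Continuous fun t : ℝ => (x, t))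
  nonneg := W_nonneg x
  zero := by
    rw [W_zero]
    rintro n ⟨h, -⟩
    have : 0 < (2 : ℝ) ^ n * lft (x n) := mul_pos (by positivity) (lft_pos _)
    linarith
  one := by
    rw [W_zero]
    rintro n ⟨-, h⟩
    norm_num at h

lemma W_shift (x : ℤ → Bool) (t : ℝ) (ht : t ∈ Icc (0 : ℝ) 1) :
    W (sh 1 x) t = 0 ↔ W x (2 * t / (1 + t)) = 0 := by
  have h1 : 0 < 1 + t := by linarith [ht.1]
  have h2 : 1 - 2 * t / (1 + t) = (1 - t) / (1 + t) := by field_simp; ring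
  rw [W_zero, W_zero]
  refine (Equiv.addRight (1 : ℤ)).forall_congr fun n => ?_
  simp only [sh, Equiv.coe_addRight, h2]
  rw [mul_div_assoc', mul_div_assoc', div_lt_div_iff_of_pos_right h1,
    div_lt_div_iff_of_pos_right h1, zpow_add_one₀ two_ne_zero (n + 1),
    zpow_add_one₀ two_ne_zero n]
  refine not_congr (and_congr ?_ ?_) <;> constructor <;> intro h <;> linarith

lemma shift_homeo (x : ℤ → Bool) : Nonempty (KK (W (sh 1 x)) ≃ₜ KK (W x)) := by
  refine homeo_of (W_adm _) (W_adm _) (fun t => 2 * t / (1 + t)) ?_ ?_ (W_shift x)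
  · refine ContinuousOn.div (by fun_prop) (by fun_prop) ?_
    intro t ht
    linarith [ht.1]
  · refine BijOn.mk ?_ ?_ ?_
    · intro t ht
      have h1 : 0 < 1 + t := by linarith [ht.1]
      refine ⟨div_nonneg (by linarith [ht.1]) h1.le, ?_⟩
      rw [div_le_one h1]
      linarith [ht.2]
    · intro t ht s hs h
      have h1 : 0 < 1 + t := by linarith [ht.1]
      have h2 : 0 < 1 + s := by linarith [hs.1]
      simp only at h
      rw [div_eq_div_iff h1.ne' h2.ne'] at h
      linarith
    · intro t ht
      have h1 : 0 < 2 - t := by linarith [ht.2]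
      refine ⟨t / (2 - t), ⟨div_nonneg ht.1 h1.le, ?_⟩, ?_⟩
      · rw [div_le_one h1]; linarith [ht.2]
      · have : 1 + t / (2 - t) = 2 / (2 - t) := by field_simp; ring
        simp only [this]
        field_simp

lemma sh_homeo_nat (k : ℕ) : ∀ x : ℤ → Bool, Nonempty (KK (W (sh k x)) ≃ₜ KK (W x)) := by
  induction k with
  | zero =>
    intro x
    have : sh ((0 : ℕ) : ℤ) x = x := by funext n; simp [sh]
    rw [this]
    exact ⟨Homeomorph.refl _⟩
  | succ k ih =>
    intro x
    have : sh ((k + 1 : ℕ) : ℤ) x = sh k (sh 1 x) := by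
      funext n; simp [sh, add_assoc]
    rw [this]
    obtain ⟨e⟩ := ih (sh 1 x)
    obtain ⟨f⟩ := shift_homeo x
    exact ⟨e.trans f⟩

lemma sh_homeo_int (k : ℤ) (x : ℤ → Bool) : Nonempty (KK (W (sh k x)) ≃ₜ KK (W x)) := by
  obtain ⟨m, rfl | rfl⟩ := k.eq_nat_or_neg
  · exact sh_homeo_nat m x
  · obtain ⟨e⟩ := sh_homeo_nat m (sh (-m) x)
    have : sh m (sh (-m) x) = x := by funext n; simp [sh]
    rw [this] at e
    exact ⟨e.symm⟩

/-! ### Decoding -/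

/-- Coding points. -/
noncomputable def lp (n : ℤ) (b : Bool) : ℝ := 2 ^ n * lft b / (1 + 2 ^ n * lft b)

lemma frac_lt {a t : ℝ} (ha : 0 < a) : a / (1 + a) < t ↔ a * (1 - t) < t := by
  rw [div_lt_iff₀ (by linarith)]
  constructor <;> intro h <;> linarith

lemma lt_frac {a t : ℝ} (ha : 0 < a) : t < a / (1 + a) ↔ t < a * (1 - t) := by
  rw [lt_div_iff₀ (by linarith)]
  constructor <;> intro h <;> linarith

lemma frac_lt_frac {a b : ℝ} (ha : 0 < a) (hb : 0 < b) : a / (1 + a) < b / (1 + b) ↔ a < b := by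
  rw [div_lt_div_iff₀ (by linarith) (by linarith)]
  constructor <;> intro h <;> linarith

lemma lpos (n : ℤ) (b : Bool) : 0 < (2 : ℝ) ^ n * lft b := mul_pos (by positivity) (lft_pos _)

lemma mem_FF (x : ℤ → Bool) (t : ℝ) : t ∈ FF (W x) ↔
    (∀ n, ¬ (lp n (x n) < t ∧ t < lp (n + 1) false)) ∧ t ∈ Ioo (0 : ℝ) 1 := by
  change W x t = 0 ∧ _ ↔ _
  rw [W_zero]
  refine and_congr_left fun _ => forall_congr' fun n => not_congr ?_
  unfold lp
  rw [frac_lt (lpos _ _), lt_frac (lpos _ _)]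
  simp [lft]

lemma lp_mem (n : ℤ) (b : Bool) : lp n b ∈ Ioo (0 : ℝ) 1 := by
  have := lpos n b
  unfold lp
  constructor
  · positivity
  · rw [div_lt_one (by linarith)]; linarith

lemma lp_lt_next (n : ℤ) (b : Bool) : lp n b < lp (n + 1) false := by
  unfold lp
  rw [frac_lt_frac (lpos _ _) (lpos _ _), zpow_add_one₀ two_ne_zero]
  have : (0 : ℝ) < 2 ^ n := by positivity
  cases b <;> simp [lft] <;> linarith

lemma lp_lt_true (n : ℤ) : lp n false < lp n true := by
  unfold lp
  rw [frac_lt_frac (lpos _ _) (lpos _ _)]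
  have : (0 : ℝ) < 2 ^ n := by positivity
  simp [lft]; linarith

lemma lp_le (n : ℤ) (b : Bool) : lp n false ≤ lp n b := by
  cases b
  · exact le_rfl
  · exact (lp_lt_true n).le

lemma lp_mono : StrictMono fun n : ℤ => lp n false :=
  strictMono_int_of_lt_succ fun n => lp_lt_next n false

lemma lp_cover {t : ℝ} (ht : t ∈ Ioo (0 : ℝ) 1) :
    ∃ n : ℤ, lp n false ≤ t ∧ t < lp (n + 1) false := by
  have h1 : 0 < 1 - t := by linarith [ht.2]
  obtain ⟨n, hn⟩ := exists_mem_Ico_zpow (div_pos ht.1 h1) (one_lt_two (α := ℝ))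
  refine ⟨n, ?_, ?_⟩
  · unfold lp
    rw [← not_lt, lt_frac (lpos _ _), not_lt]
    have := (le_div_iff₀ h1).1 hn.1
    simpa [lft] using this
  · unfold lp
    rw [lt_frac (lpos _ _)]
    have := (div_lt_iff₀ h1).1 hn.2
    simpa [lft] using this

/-- Points between `lp n false` and `lp n (x n)` belong to the zero set. -/
lemma mem_of_between (x : ℤ → Bool) (n : ℤ) {t : ℝ} (h1 : lp n false ≤ t) (h2 : t ≤ lp n (x n)) :
    t ∈ FF (W x) := by
  rw [mem_FF]
  refine ⟨?_, (lp_mem n false).1.trans_le h1, h2.trans_lt (lp_mem n _).2⟩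
  rintro m ⟨ha, hb⟩
  have h3 : n < m + 1 := lp_mono.lt_iff_lt.1 (h1.trans_lt hb)
  have h4 : lp m false < lp (n + 1) false :=
    (lp_le m (x m)).trans_lt (ha.trans (h2.trans_lt (lp_lt_next n _)))
  have h5 : m < n + 1 := lp_mono.lt_iff_lt.1 h4
  have : m = n := by omega
  subst this
  exact absurd h2 (not_le.2 ha)

lemma exists_between_of_mem (x : ℤ → Bool) {t : ℝ} (ht : t ∈ FF (W x)) :
    ∃ n, lp n false ≤ t ∧ t ≤ lp n (x n) := by
  rw [mem_FF] at ht
  obtain ⟨n, h1, h2⟩ := lp_cover ht.2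
  refine ⟨n, h1, ?_⟩
  by_contra h
  exact ht.1 n ⟨not_le.1 h, h2⟩

lemma right_iff (x : ℤ → Bool) (c : FF (W x)) : (∃ a, a ⋖ c) ↔ ∃ n, c.1 = lp n false := by
  constructor
  · rintro ⟨a, hac, hcov⟩
    obtain ⟨n, h1, h2⟩ := exists_between_of_mem x c.2
    refine ⟨n, ?_⟩
    by_contra hne
    have h3 : lp n false < c.1 := lt_of_le_of_ne h1 (Ne.symm hne)
    obtain ⟨z, hz1, hz2⟩ := exists_between (max_lt (show a.1 < c.1 from hac) h3)
    rw [max_lt_iff] at hz1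
    exact hcov (c := ⟨z, mem_of_between x n hz1.2.le (hz2.le.trans h2)⟩) hz1.1 hz2
  · rintro ⟨n, hn⟩
    refine ⟨⟨lp (n - 1) (x (n - 1)), mem_of_between x (n - 1) (lp_le _ _) le_rfl⟩, ?_, ?_⟩
    · change lp (n - 1) (x (n - 1)) < c.1
      rw [hn]
      simpa using lp_lt_next (n - 1) (x (n - 1))
    · intro z h1 h2
      refine ((mem_FF x z.1).1 z.2).1 (n - 1) ⟨h1, ?_⟩
      have h2' : z.1 < c.1 := h2
      rw [hn] at h2'
      simpa using h2'

lemma left_iff (x : ℤ → Bool) (c : FF (W x)) {n : ℤ} (hc : c.1 = lp n false) :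
    (∃ b, c ⋖ b) ↔ x n = false := by
  constructor
  · rintro ⟨b, hcb, hcov⟩
    by_contra hx
    have hx' : x n = true := by simpa using hx
    have h3 : c.1 < lp n (x n) := by rw [hc, hx']; exact lp_lt_true n
    obtain ⟨z, hz1, hz2⟩ := exists_between (lt_min (show c.1 < b.1 from hcb) h3)
    rw [lt_min_iff] at hz2
    exact hcov (c := ⟨z, mem_of_between x n (hc ▸ hz1.le) hz2.2.le⟩) hz1 hz2.1
  · intro hx
    refine ⟨⟨lp (n + 1) false, mem_of_between x (n + 1) le_rfl (lp_le _ _)⟩, ?_, ?_⟩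
    · change c.1 < lp (n + 1) false
      rw [hc]
      exact lp_lt_next n false
    · intro z h1 h2
      refine ((mem_FF x z.1).1 z.2).1 n ⟨?_, h2⟩
      rw [hx, ← hc]
      exact h1

lemma covBy_map {α β : Type} [LinearOrder α] [LinearOrder β] (e : α ≃o β) {a b : α}
    (h : a ⋖ b) : e a ⋖ e b := by
  refine ⟨e.strictMono h.1, fun c h1 h2 => ?_⟩
  refine h.2 (c := e.symm c) ?_ ?_
  · rwa [← e.lt_iff_lt, e.apply_symm_apply]
  · rwa [← e.lt_iff_lt, e.apply_symm_apply]

lemma decode (x y : ℤ → Bool) (e : FF (W x) ≃o FF (W y)) : ∃ k, sh k x = y := by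
  let P : ∀ (x : ℤ → Bool) (n : ℤ), FF (W x) :=
    fun x n => ⟨lp n false, mem_of_between x n le_rfl (lp_le _ _)⟩
  have step : ∀ (x y : ℤ → Bool) (e : FF (W x) ≃o FF (W y)) (n : ℤ), ∃ m, e (P x n) = P y m := by
    intro x y e n
    obtain ⟨a, ha⟩ := (right_iff x (P x n)).2 ⟨n, rfl⟩
    obtain ⟨m, hm⟩ := (right_iff y (e (P x n))).1 ⟨e a, covBy_map e ha⟩
    exact ⟨m, Subtype.ext hm⟩
  have hP : ∀ x, StrictMono (P x) := fun x a b hab => lp_mono hab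
  choose φ hφ using step x y e
  choose ψ hψ using step y x e.symm
  have hmono : StrictMono φ := by
    intro a b hab
    rw [← (hP y).lt_iff_lt, ← hφ, ← hφ]
    exact e.strictMono (hP x hab)
  have hsurj : Function.Surjective φ := by
    intro m
    refine ⟨ψ m, (hP y).injective ?_⟩
    rw [← hφ, ← hψ, e.apply_symm_apply]
  let f : ℤ ≃o ℤ := hmono.orderIsoOfSurjective φ hsurj
  have hsucc : ∀ n, φ (n + 1) = φ n + 1 := by
    intro n
    have := f.map_succ n
    simpa [f] using this
  have hlin : ∀ n, φ n = n + φ 0 := by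
    intro n
    induction n using Int.induction_on with
    | zero => simp
    | succ i ih => rw [hsucc, ih]; ring
    | pred i ih =>
      have := hsucc (-(i : ℤ) - 1)
      rw [sub_add_cancel, ih] at this
      linarith
  have hxy : ∀ n, x n = y (φ n) := by
    intro n
    have h1 := left_iff x (P x n) (n := n) rfl
    have h2 := left_iff y (P y (φ n)) (n := φ n) rfl
    have h3 : (∃ b, P x n ⋖ b) ↔ ∃ b, P y (φ n) ⋖ b := by
      rw [← hφ]
      constructor
      · rintro ⟨b, hb⟩
        exact ⟨e b, covBy_map e hb⟩
      · rintro ⟨b, hb⟩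
        refine ⟨e.symm b, ?_⟩
        simpa using covBy_map e.symm hb
    rw [h1, h2] at h3
    revert h3
    cases x n <;> cases y (φ n) <;> simp
  refine ⟨-(φ 0), ?_⟩
  funext n
  simp only [sh]
  rw [hxy, hlin]
  simp

lemma class_countable (x : ℤ → Bool) : {y | Nonempty (KK (W x) ≃ₜ KK (W y))}.Countable := by
  have horb : ∀ z : ℤ → Bool, (range fun k : ℤ => sh k z).Countable := fun z => countable_range _
  by_cases h : ∃ z, Nonempty (FF (W x) ≃o (FF (W z))ᵒᵈ)
  · obtain ⟨z, ⟨f⟩⟩ := h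
    refine ((horb x).union (horb z)).mono ?_
    rintro y ⟨hy⟩
    rcases homeo_order (W_adm x) (W_adm y) hy with ⟨⟨e⟩⟩ | ⟨⟨e⟩⟩
    · exact Or.inl (decode x y e)
    · exact Or.inr (decode z y (f.symm.trans e).dual)
  · refine (horb x).mono ?_
    rintro y ⟨hy⟩
    rcases homeo_order (W_adm x) (W_adm y) hy with ⟨⟨e⟩⟩ | ⟨⟨e⟩⟩
    · exact decode x y e
    · exact absurd ⟨y, ⟨e⟩⟩ h

lemma KK_closed : IsClosed {p : (ℤ → Bool) × (ℝ × ℝ) | p.2 ∈ KK (W p.1)} := by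
  refine IsClosed.inter ?_ ?_
  · exact isClosed_Icc.preimage (f := fun p : (ℤ → Bool) × (ℝ × ℝ) => p.2.1) (by fun_prop)
  · exact isClosed_eq (by fun_prop) (W_cont.comp
      (by fun_prop : Continuous fun p : (ℤ → Bool) × (ℝ × ℝ) => (p.1, p.2.1)))

lemma KK_bdd : ∃ B : Set (ℝ × ℝ), IsCompact B ∧ ∀ x, KK (W x) ⊆ B := by
  let M : ℝ := ∑' n : ℤ, (1 / 2 : ℝ) ^ n.natAbs
  refine ⟨Icc 0 1 ×ˢ Icc (-M) M, isCompact_Icc.prod isCompact_Icc, ?_⟩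
  rintro x q ⟨h1, h2⟩
  refine ⟨h1, abs_le.1 ?_⟩
  rw [h2]
  exact W_le x _

lemma KK_compact (x) : CompactSpace (KK (W x)) := by
  obtain ⟨B, hB, hKB⟩ := KK_bdd
  refine isCompact_iff_compactSpace.1 (hB.of_isClosed_subset ?_ (hKB x))
  exact KK_closed.preimage (by fun_prop : Continuous fun q : ℝ × ℝ => (x, q))

lemma clopens_countable {X : Type} [TopologicalSpace X] [CompactSpace X]
    [SecondCountableTopology X] : {U : Set X | IsClopen U}.Countable := by
  have hfin : {t : Set (Set X) | t.Finite ∧ t ⊆ countableBasis X}.Countable :=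
    countable_ofPred_finite_subset (countable_countableBasis X)
  refine (hfin.image sUnion).mono ?_
  intro U hU
  obtain ⟨S, hS, hSU⟩ := (isBasis_countableBasis X).open_eq_sUnion hU.isOpen
  have hc : IsCompact U := hU.isClosed.isCompact
  obtain ⟨T, hT, hTf, hUT⟩ := hc.elim_finite_subcover_image (b := S) (c := id)
    (fun s hs => (isBasis_countableBasis X).isOpen (hS hs))
    (by rw [hSU, sUnion_eq_biUnion]; rfl)
  refine ⟨T, ⟨hTf, hT.trans hS⟩, ?_⟩
  apply subset_antisymm
  · rw [hSU]
    exact sUnion_subset_sUnion hT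
  · rw [sUnion_eq_biUnion]
    exact hUT

lemma no_universal (X : Type) [TopologicalSpace X] [CompactSpace X] [MetrizableSpace X]
    (huniq : ∀ (C : Type) [TopologicalSpace C] [CompactSpace C] [ConnectedSpace C]
        [MetrizableSpace C], ∃! S : Set X, (∃ x : X, S = connectedComponent x) ∧
          Nonempty (C ≃ₜ S)) : False := by
  let _ := metrizableSpaceMetric X
  have hpol : PolishSpace (ℤ → Bool) := by
    let _ := metrizableSpaceMetric (ℤ → Bool)
    infer_instance
  let K : (ℤ → Bool) → Set (ℝ × ℝ) := fun x => KK (W x)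
  obtain ⟨B, hB, hKB⟩ := KK_bdd
  -- uniqueness and existence for the family
  have hex : ∀ x, ∃ p : X, Nonempty (K x ≃ₜ connectedComponent p) := by
    intro x
    have := KK_compact x
    have := KK_connected (W_adm x)
    obtain ⟨S, ⟨⟨p, rfl⟩, h⟩, -⟩ := huniq (KK (W x))
    exact ⟨p, h⟩
  have hun : ∀ x (p q : X), Nonempty (K x ≃ₜ connectedComponent p) →
      Nonempty (K x ≃ₜ connectedComponent q) → connectedComponent p = connectedComponent q := by
    intro x p q hp hq
    have := KK_compact x
    have := KK_connected (W_adm x)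
    exact (huniq (KK (W x))).unique ⟨⟨p, rfl⟩, hp⟩ ⟨⟨q, rfl⟩, hq⟩
  let A : Set X → Set (ℤ → Bool) := fun U => {x | ∃ p ∈ U, Nonempty (K x ≃ₜ connectedComponent p)}
  have hAc : ∀ U, IsClopen U → (A U)ᶜ = A Uᶜ := by
    intro U hU
    ext x
    constructor
    · intro hx
      obtain ⟨p, hp⟩ := hex x
      exact ⟨p, fun hpU => hx ⟨p, hpU, hp⟩, hp⟩
    · rintro ⟨p, hpU, hp⟩ ⟨q, hqU, hq⟩
      have h := hun x p q hp hq
      have h2 : connectedComponent q ⊆ U := hU.connectedComponent_subset hqU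
      exact hpU (h2 (h ▸ mem_connectedComponent))
  have hAm : ∀ U, IsClopen U → BaireMeasurableSet (A U) := by
    intro U hU
    borelize (ℤ → Bool)
    have h1 : MeasureTheory.AnalyticSet (A U) :=
      analytic K KK_closed B hB hKB U hU.isClosed
    have h2 : MeasureTheory.AnalyticSet (A U)ᶜ := by
      rw [hAc U hU]
      exact analytic K KK_closed B hB hKB Uᶜ hU.compl.isClosed
    exact (h1.measurableSet_of_compl h2).baireMeasurableSet
  have hinv : ∀ U k x, x ∈ A U ↔ sh k x ∈ A U := by
    intro U k x
    obtain ⟨e⟩ := sh_homeo_int k x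
    constructor
    · rintro ⟨p, hpU, ⟨f⟩⟩
      exact ⟨p, hpU, ⟨e.trans f⟩⟩
    · rintro ⟨p, hpU, ⟨f⟩⟩
      exact ⟨p, hpU, ⟨e.symm.trans f⟩⟩
  have hgen : ∀ᶠ x in residual (ℤ → Bool), ∀ U ∈ {U : Set X | IsClopen U},
      (x ∈ A U ↔ A U ∈ residual (ℤ → Bool)) := by
    rw [eventually_countable_ball clopens_countable]
    intro U hU
    rcases zero_one (hAm U hU) (hinv U) with h | h
    · filter_upwards [h] with x hx
      simp [hx, h]
    · filter_upwards [h] with x hx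
      refine iff_of_false hx fun h' => ?_
      have := (Filter.inter_mem h h')
      rw [compl_inter_self] at this
      exact (dense_of_mem_residual this).nonempty.elim fun _ => id
  obtain ⟨x, hx⟩ := (dense_of_mem_residual hgen).nonempty
  obtain ⟨y, hy, hyx⟩ :=
    (dense_of_mem_residual (Filter.inter_mem hgen (countable_compl (class_countable x)))).nonempty
  apply hyx
  obtain ⟨p, hp⟩ := hex x
  obtain ⟨q, hq⟩ := hex y
  have hpq : q ∈ connectedComponent p := by
    rw [connectedComponent_eq_iInter_isClopen, mem_iInter]
    rintro ⟨U, hU, hpU⟩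
    have h1 : y ∈ A U := (hy U hU).2 ((hx U hU).1 ⟨p, hpU, hp⟩)
    obtain ⟨r, hrU, hr⟩ := h1
    have h2 := hun y q r hq hr
    exact hU.connectedComponent_subset hrU (h2 ▸ mem_connectedComponent)
  have h := connectedComponent_eq hpq
  obtain ⟨f⟩ := hp
  rw [h] at f
  obtain ⟨g⟩ := hq
  exact ⟨f.trans g.symm⟩

end UC

/-- There is no compact metrizable space `X` such that every continuum is homeomorphic
to exactly one connected component of `X`. -/
theorem stmt_19 : ¬ UniversalUniqueComponentSpace := by
  rintro ⟨X, hcomp, hmetr, huniq⟩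
  exact UC.no_universal X huniq
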